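/- arXiv:1806.10731 — 2 statements merged into one kernel-verified Lean document; each statement's English description precedes it below -/
import Mathlib

section
/- For n ≥ 3 with n ≡ 0 (mod 3), the wheel graph W_{n+1} = K_1 + C_n admits a J-colouring and the maximum number of colours in a J-colouring of W_{n+1} equals 4; that is, J(W_{n+1}) = 4. -/
open SimpleGraph

/-- `c` is a proper colouring of `G` with colours `Fin k` such that the closed
neighbourhood of every vertex contains all `k` colours (a J-colouring). -/
def IsJColoring {V : Type*} (G : SimpleGraph V) (k : ℕ) (c : V → Fin k) : Prop :=
  (∀ ⦃u v : V⦄, G.Adj u v → c u ≠ c v) ∧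
  ∀ v : V, ∀ i : Fin k, ∃ u : V, (u = v ∨ G.Adj v u) ∧ c u = i

/-- `G` has a J-colouring with `k` colours. -/
def HasJColoring {V : Type*} (G : SimpleGraph V) (k : ℕ) : Prop :=
  ∃ c : V → Fin k, IsJColoring G k c

/-- `G` admits a J-colouring (with some number `k ≥ 1` of colours). -/
def AdmitsJColoring {V : Type*} (G : SimpleGraph V) : Prop :=
  ∃ k : ℕ, 1 ≤ k ∧ HasJColoring G k

/-- `c` is a proper colouring of `G` with colours `Fin k` such that the closed
neighbourhood of every internal vertex (vertex of degree at least 2) contains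
all `k` colours (a J*-colouring). -/
def IsJStarColoring {V : Type*} (G : SimpleGraph V) (k : ℕ) (c : V → Fin k) : Prop :=
  (∀ ⦃u v : V⦄, G.Adj u v → c u ≠ c v) ∧
  ∀ v : V, (∃ a b : V, a ≠ b ∧ G.Adj v a ∧ G.Adj v b) →
    ∀ i : Fin k, ∃ u : V, (u = v ∨ G.Adj v u) ∧ c u = i

/-- `G` has a J*-colouring with `k` colours. -/
def HasJStarColoring {V : Type*} (G : SimpleGraph V) (k : ℕ) : Prop :=
  ∃ c : V → Fin k, IsJStarColoring G k c

/-- The wheel graph `W_{n+1} = K_1 + C_n`: the cycle graph on `Fin n` together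
with a central vertex `none` adjacent to every cycle vertex. -/
def wheelGraph (n : ℕ) : SimpleGraph (Option (Fin n)) :=
  SimpleGraph.fromRel (fun u v =>
    (∃ i : Fin n, u = none ∧ v = some i) ∨
    (∃ i j : Fin n, u = some i ∧ v = some j ∧ (SimpleGraph.cycleGraph n).Adj i j))

/-- The Jahangir graph `J_{n,m}`: the cycle graph on `Fin (n*m)` together with a
central vertex `none` adjacent exactly to the `m` cycle vertices whose index is
a multiple of `n`. -/
def jahangirGraph (n m : ℕ) : SimpleGraph (Option (Fin (n * m))) :=
  SimpleGraph.fromRel (fun u v =>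
    (∃ i : Fin (n * m), u = none ∧ v = some i ∧ n ∣ (i : ℕ)) ∨
    (∃ i j : Fin (n * m), u = some i ∧ v = some j ∧ (SimpleGraph.cycleGraph (n * m)).Adj i j))


theorem wheelGraph_adj_none_some {n : ℕ} (i : Fin n) :
    (wheelGraph n).Adj none (some i) := by
  simp [wheelGraph]

theorem wheelGraph_adj_some_some {n : ℕ} {i j : Fin n} :
    (wheelGraph n).Adj (some i) (some j) ↔ (cycleGraph n).Adj i j := by
  simp only [wheelGraph, fromRel_adj]
  constructor
  · rintro ⟨-, (⟨_, h, -⟩ | ⟨a, b, ha, hb, h⟩) | (⟨_, h, -⟩ | ⟨a, b, ha, hb, h⟩)⟩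
    · cases h
    · cases ha; cases hb; exact h
    · cases h
    · cases ha; cases hb; exact h.symm
  · intro h
    exact ⟨fun e => h.ne (Option.some.inj e), .inl (.inr ⟨i, j, rfl, rfl, h⟩)⟩

/-- Adjacency in the cycle graph in terms of the values of the vertices. -/
theorem cycleGraph_adj_iff_val {n : ℕ} (hn : 2 ≤ n) {i j : Fin n} :
    (cycleGraph n).Adj i j ↔ (i : ℕ) + 1 = j ∨ (j : ℕ) + 1 = i ∨
      ((i : ℕ) = 0 ∧ (j : ℕ) + 1 = n) ∨ ((j : ℕ) = 0 ∧ (i : ℕ) + 1 = n) := by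
  have key (a b : Fin n) :
      (a - b).val = 1 ↔ (b : ℕ) + 1 = a ∨ ((a : ℕ) = 0 ∧ (b : ℕ) + 1 = n) := by
    have ha := a.isLt
    have hb := b.isLt
    rcases le_or_gt b a with h | h
    · rw [Fin.coe_sub_iff_le.mpr h]
      rw [Fin.le_def] at h
      omega
    · rw [Fin.coe_sub_iff_lt.mpr h]
      rw [Fin.lt_def] at h
      omega
  rw [cycleGraph_adj', key, key]
  tauto

/-- The number of colours of a J-colouring is at most the size of any finite set covering a closed
neighbourhood. -/
theorem HasJColoring.le_card {V : Type*} {G : SimpleGraph V} {k : ℕ} (h : HasJColoring G k)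
    (v : V) (s : Finset V) (hv : v ∈ s) (hs : ∀ u, G.Adj v u → u ∈ s) : k ≤ s.card := by
  obtain ⟨c, -, hc⟩ := h
  have hsurj : Set.SurjOn c s (Finset.univ : Finset (Fin k)) := by
    intro i _
    obtain ⟨u, hu, rfl⟩ := hc v i
    exact ⟨u, hu.elim (fun e => e ▸ hv) (hs u), rfl⟩
  simpa using Finset.card_le_card_of_surjOn c hsurj

theorem HasJColoring.wheelGraph_le_four {n k : ℕ} (hn : 3 ≤ n)
    (h : HasJColoring (wheelGraph n) k) : k ≤ 4 := by
  refine (h.le_card (some ⟨0, by omega⟩) {none, some ⟨0, by omega⟩, some ⟨1, by omega⟩,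
    some ⟨n - 1, by omega⟩} (by simp) ?_).trans Finset.card_le_four
  rintro (_ | u) hu
  · simp
  · rw [wheelGraph_adj_some_some, cycleGraph_adj_iff_val (by omega)] at hu
    simp only [Finset.mem_insert, Finset.mem_singleton, Option.some.injEq, Fin.ext_iff]
    simp only at hu
    omega

/-- The colouring of the wheel giving the centre colour `3` and the rim vertex `i` colour
`i % 3`. -/
def wheelColoring (n : ℕ) : Option (Fin n) → Fin 4
  | none => 3
  | some i => ⟨i % 3, by omega⟩

theorem isJColoring_wheelColoring {n : ℕ} (hn : 3 ≤ n) (h3 : n % 3 = 0) :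
    IsJColoring (wheelGraph n) 4 (wheelColoring n) := by
  constructor
  · rintro (_ | u) (_ | v) h
    · exact absurd h (SimpleGraph.irrefl _)
    · simp only [wheelColoring, ne_eq, Fin.ext_iff]
      omega
    · simp only [wheelColoring, ne_eq, Fin.ext_iff]
      omega
    · rw [wheelGraph_adj_some_some, cycleGraph_adj_iff_val (by omega)] at h
      simp only [wheelColoring, ne_eq, Fin.ext_iff]
      omega
  · intro v i
    have hi := i.isLt
    by_cases hi3 : i.val = 3
    · refine ⟨none, ?_, Fin.ext hi3.symm⟩
      rcases v with _ | v
      · exact .inl rfl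
      · exact .inr (wheelGraph_adj_none_some v).symm
    · rcases v with _ | v
      · refine ⟨some ⟨i, by omega⟩, .inr (wheelGraph_adj_none_some _), Fin.ext ?_⟩
        simp only [wheelColoring]
        omega
      · have hv := v.isLt
        obtain ⟨u, hu, hui, hvu⟩ : ∃ u < n, u % 3 = i ∧ (u = v ∨ (v : ℕ) + 1 = u ∨ u + 1 = v ∨
            ((v : ℕ) = 0 ∧ u + 1 = n) ∨ (u = 0 ∧ (v : ℕ) + 1 = n)) := by
          by_cases h0 : (v : ℕ) % 3 = i
          · exact ⟨v, hv, h0, .inl rfl⟩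
          by_cases h1 : ((v : ℕ) + 1) % 3 = i
          · by_cases hl : (v : ℕ) + 1 = n
            · exact ⟨0, by omega, by omega, by omega⟩
            · exact ⟨v + 1, by omega, h1, by omega⟩
          · by_cases hz : (v : ℕ) = 0
            · exact ⟨n - 1, by omega, by omega, by omega⟩
            · exact ⟨v - 1, by omega, by omega, by omega⟩
        refine ⟨some ⟨u, hu⟩, ?_, Fin.ext hui⟩
        rw [wheelGraph_adj_some_some, cycleGraph_adj_iff_val (by omega), Option.some.injEq,
          Fin.ext_iff]
        exact hvu

theorem stmt7 (n : ℕ) (hn : 3 ≤ n) (h3 : n % 3 = 0) :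
    AdmitsJColoring (wheelGraph n) ∧
      IsGreatest {k : ℕ | HasJColoring (wheelGraph n) k} 4 := by
  have h4 : HasJColoring (wheelGraph n) 4 := ⟨_, isJColoring_wheelColoring hn h3⟩
  exact ⟨⟨4, by norm_num, h4⟩, h4, fun _ h => h.wheelGraph_le_four hn⟩
end

section
/- For every k ≥ 1, n odd with n ≥ 1, n ≡ 1 (mod 3), and m = 4k, the Jahangir graph J_{n,m} admits a J-colouring. -/
open SimpleGraph

/-- The distance from `i` to the nearest multiple of `2 * n`. -/
def evenMultipleDist (n i : ℕ) : ℕ := min (i % (2 * n)) (2 * n - i % (2 * n))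

lemma evenMultipleDist_mod {n N : ℕ} (h : 2 * n ∣ N) (i : ℕ) :
    evenMultipleDist n (i % N) = evenMultipleDist n i := by
  simp [evenMultipleDist, Nat.mod_mod_of_dvd _ h]

lemma succ_mod_cases {p : ℕ} (hp : 0 < p) (i : ℕ) :
    (i + 1) % p = i % p + 1 ∧ i % p + 1 < p ∨ (i + 1) % p = 0 ∧ i % p + 1 = p := by
  have h := Nat.mod_lt i hp
  rw [← Nat.mod_add_mod]
  rcases Nat.lt_or_ge (i % p + 1) p with h' | h'
  · exact Or.inl ⟨Nat.mod_eq_of_lt h', h'⟩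
  · have h'' : i % p + 1 = p := by omega
    exact Or.inr ⟨by rw [h'', Nat.mod_self], h''⟩

lemma evenMultipleDist_succ {n : ℕ} (hn : 1 ≤ n) (i : ℕ) :
    evenMultipleDist n (i + 1) = evenMultipleDist n i + 1 ∨
      evenMultipleDist n i = evenMultipleDist n (i + 1) + 1 := by
  unfold evenMultipleDist
  rcases succ_mod_cases (p := 2 * n) (by omega) i with h | h <;> omega

lemma dvd_iff_mod_two_mul {n : ℕ} (hn : 1 ≤ n) (i : ℕ) :
    n ∣ i ↔ i % (2 * n) = 0 ∨ i % (2 * n) = n := by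
  have hlt := Nat.mod_lt i (show 0 < 2 * n by omega)
  rw [← Nat.dvd_mod_iff (show n ∣ 2 * n from ⟨2, by ring⟩)]
  constructor
  · rintro ⟨q, hq⟩
    rw [hq] at hlt ⊢
    have : q < 2 := by nlinarith
    interval_cases q <;> simp
  · rintro (h | h) <;> simp [h]

lemma evenMultipleDist_of_not_dvd {n : ℕ} (hn : 1 ≤ n) {i : ℕ} (h : ¬ n ∣ i + 1) :
    (evenMultipleDist n i = evenMultipleDist n (i + 1) + 1 ∧
      evenMultipleDist n (i + 1) = evenMultipleDist n (i + 2) + 1) ∨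
    (evenMultipleDist n (i + 1) = evenMultipleDist n i + 1 ∧
      evenMultipleDist n (i + 2) = evenMultipleDist n (i + 1) + 1) := by
  rw [dvd_iff_mod_two_mul hn] at h
  unfold evenMultipleDist
  rcases succ_mod_cases (p := 2 * n) (by omega) i with h1 | h1 <;>
  rcases succ_mod_cases (p := 2 * n) (by omega) (i + 1) with h2 | h2 <;>
  simp only [add_assoc, Nat.reduceAdd] at h2 <;> omega

lemma evenMultipleDist_of_dvd {n : ℕ} (hn : 1 ≤ n) {i : ℕ} (h : n ∣ i) :
    (evenMultipleDist n i = 0 ∧ evenMultipleDist n (i + 1) = 1) ∨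
    (evenMultipleDist n i = n ∧ evenMultipleDist n (i + 1) + 1 = n) := by
  rw [dvd_iff_mod_two_mul hn] at h
  unfold evenMultipleDist
  rcases succ_mod_cases (p := 2 * n) (by omega) i with h1 | h1 <;> omega

lemma cycleGraph_adj_iff_succ_mod {N : ℕ} (hN : 2 ≤ N) (i j : Fin N) :
    (cycleGraph N).Adj i j ↔ (i + 1 : ℕ) % N = j ∨ (j + 1 : ℕ) % N = i := by
  have key : ∀ a b : Fin N, (a - b).val = 1 ↔ (b + 1 : ℕ) % N = a := by
    intro a b
    have ha := a.isLt
    have hb := b.isLt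
    rw [Fin.val_sub]
    rcases succ_mod_cases (p := N) (by omega) b with h | h <;>
    rcases Nat.lt_or_ge (a : ℕ) b with h' | h'
    all_goals rw [Nat.mod_eq_of_lt hb] at h
    · rw [Nat.mod_eq_of_lt (by omega)]; omega
    · rw [show N - (b : ℕ) + a = (a - b) + N by omega, Nat.add_mod_right,
        Nat.mod_eq_of_lt (by omega)]; omega
    · rw [Nat.mod_eq_of_lt (by omega)]; omega
    · rw [show N - (b : ℕ) + a = (a - b) + N by omega, Nat.add_mod_right,
        Nat.mod_eq_of_lt (by omega)]; omega
  rw [cycleGraph_adj', key, key, or_comm]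

lemma jahangirGraph_adj_none_some {n m : ℕ} (i : Fin (n * m)) :
    (jahangirGraph n m).Adj none (some i) ↔ n ∣ (i : ℕ) := by
  simp [jahangirGraph]

lemma jahangirGraph_adj_some_some {n m : ℕ} (i j : Fin (n * m)) :
    (jahangirGraph n m).Adj (some i) (some j) ↔ (cycleGraph (n * m)).Adj i j := by
  simp only [jahangirGraph, fromRel_adj]
  constructor
  · rintro ⟨-, h | h⟩
    · simpa using h
    · simpa using (show (cycleGraph (n * m)).Adj j i by simpa using h).symm
  · intro h
    exact ⟨by simpa using h.ne, Or.inl (Or.inr ⟨i, j, rfl, rfl, h⟩)⟩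

/-- The colouring of the Jahangir graph giving the centre colour `2` and each cycle vertex
the residue modulo `3` of its distance to the nearest multiple of `2 * n`. -/
def jahangirColoring (n m : ℕ) : Option (Fin (n * m)) → Fin 3
  | none => 2
  | some i => ⟨evenMultipleDist n i % 3, Nat.mod_lt _ (by norm_num)⟩

theorem isJColoring_jahangirColoring {n m : ℕ} (hn : 1 ≤ n) (hn3 : n % 3 = 1)
    (hm : 2 ≤ m) (hm2 : 2 ∣ m) : IsJColoring (jahangirGraph n m) 3 (jahangirColoring n m) := by
  have hN : 2 ≤ n * m := by nlinarith
  have hdvd : 2 * n ∣ n * m := by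
    rw [mul_comm 2]
    exact Nat.mul_dvd_mul_left n hm2
  have hadj : ∀ i j : Fin (n * m), (jahangirGraph n m).Adj (some i) (some j) ↔
      (i + 1 : ℕ) % (n * m) = j ∨ (j + 1 : ℕ) % (n * m) = i := fun i j => by
    rw [jahangirGraph_adj_some_some, cycleGraph_adj_iff_succ_mod hN]
  have hcentre : ∀ i : Fin (n * m), n ∣ (i : ℕ) →
      jahangirColoring n m none ≠ jahangirColoring n m (some i) := by
    intro i hi
    have := evenMultipleDist_of_dvd hn hi
    simp only [jahangirColoring, ne_eq, Fin.ext_iff, Fin.val_two]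
    omega
  have hstep : ∀ i j : Fin (n * m), (i + 1 : ℕ) % (n * m) = j →
      jahangirColoring n m (some i) ≠ jahangirColoring n m (some j) := by
    intro i j h
    have := evenMultipleDist_succ hn i
    simp only [jahangirColoring, ne_eq, Fin.ext_iff, ← h, evenMultipleDist_mod hdvd]
    omega
  refine ⟨?_, ?_⟩
  · rintro (_ | i) (_ | j) h
    · exact absurd h (SimpleGraph.irrefl _)
    · exact hcentre j ((jahangirGraph_adj_none_some j).1 h)
    · exact (hcentre i ((jahangirGraph_adj_none_some i).1 h.symm)).symm
    · rcases (hadj i j).1 h with h | h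
      · exact hstep i j h
      · exact (hstep j i h).symm
  · rintro (_ | i) c
    · have h0 := evenMultipleDist_of_dvd hn (dvd_zero n)
      have hnn : evenMultipleDist n n = n := by
        rw [evenMultipleDist, Nat.mod_eq_of_lt (by omega)]
        omega
      have h00 : evenMultipleDist n 0 = 0 := by simp [evenMultipleDist]
      fin_cases c
      · refine ⟨some ⟨0, by omega⟩, Or.inr ((jahangirGraph_adj_none_some _).2 (dvd_zero n)), ?_⟩
        simp [jahangirColoring, h00]
      · refine ⟨some ⟨n, by nlinarith⟩, Or.inr ((jahangirGraph_adj_none_some _).2 dvd_rfl), ?_⟩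
        simp [jahangirColoring, hnn, hn3]
      · exact ⟨none, Or.inl rfl, rfl⟩
    · have hi := i.isLt
      let s : Fin (n * m) := ⟨(i + 1) % (n * m), Nat.mod_lt _ (by omega)⟩
      have hs : (jahangirGraph n m).Adj (some i) (some s) := (hadj i s).2 (Or.inl rfl)
      have hsd : (jahangirColoring n m (some s) : ℕ) = evenMultipleDist n (i + 1) % 3 := by
        simp [jahangirColoring, s, evenMultipleDist_mod hdvd]
      have hid : (jahangirColoring n m (some i) : ℕ) = evenMultipleDist n i % 3 := rfl
      have hc := c.isLt
      -- in both cases the three exhibited colours are pairwise distinct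
      suffices h : ∃ w, (jahangirGraph n m).Adj (some i) w ∧
          (jahangirColoring n m w ≠ jahangirColoring n m (some i)) ∧
          (jahangirColoring n m w ≠ jahangirColoring n m (some s)) by
        obtain ⟨w, hw, hwi, hws⟩ := h
        have his := hstep i s rfl
        have hcases : jahangirColoring n m (some i) = c ∨ jahangirColoring n m (some s) = c ∨
            jahangirColoring n m w = c := by omega
        rcases hcases with h | h | h
        · exact ⟨_, Or.inl rfl, h⟩
        · exact ⟨_, Or.inr hs, h⟩
        · exact ⟨_, Or.inr hw, h⟩
      by_cases hd : n ∣ (i : ℕ)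
      · refine ⟨none, ((jahangirGraph_adj_none_some i).2 hd).symm, hcentre i hd, ?_⟩
        have := evenMultipleDist_of_dvd hn hd
        rw [ne_eq, Fin.ext_iff, hsd]
        simp only [jahangirColoring, Fin.val_two]
        omega
      · obtain ⟨j, hj⟩ : ∃ j, (i : ℕ) = j + 1 :=
          Nat.exists_eq_succ_of_ne_zero fun h => hd (h ▸ dvd_zero n)
        let p : Fin (n * m) := ⟨j, by omega⟩
        have hpi : (p + 1 : ℕ) % (n * m) = i := by
          rw [show (p + 1 : ℕ) = i from hj.symm, Nat.mod_eq_of_lt hi]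
        refine ⟨some p, (hadj i p).2 (Or.inr hpi), hstep p i hpi, ?_⟩
        have := evenMultipleDist_of_not_dvd hn (hj ▸ hd)
        rw [ne_eq, Fin.ext_iff, hsd, hj]
        simp only [jahangirColoring, p, add_assoc, Nat.reduceAdd]
        omega

theorem stmt13 (k n : ℕ) (hk : 1 ≤ k) (hn : 1 ≤ n) (hodd : Odd n)
    (hn3 : n % 3 = 1) : AdmitsJColoring (jahangirGraph n (4 * k)) :=
  ⟨3, by norm_num, jahangirColoring n (4 * k),
    isJColoring_jahangirColoring hn hn3 (by omega) ⟨2 * k, by ring⟩⟩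
end
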